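/- Let f : ℝ^(m+k) → ℝ^k be Lipschitz near (x₀,y₀) with f(x₀,y₀) = z₀, and suppose every ℓ ∈ ∂f(x₀,y₀) satisfies Ker ℓ ∩ ({0}^m × ℝ^k) = {0}. Then there exists a germ of a bilipschitz homeomorphism φ : (ℝ^(m+k), (x₀,y₀)) → (ℝ^m × ℝ^k, (0, z₀)) such that f = π ∘ φ near (x₀,y₀), where π : ℝ^m × ℝ^k → ℝ^k is the projection onto the second factor. -/

import Mathlib

open Filter Topology

/-- The Clarke generalized Jacobian. -/
noncomputable def clarkeJacobian {E F : Type*} [NormedAddCommGroup E] [NormedSpace ℝ E]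
    [NormedAddCommGroup F] [NormedSpace ℝ F] (f : E → F) (a : E) : Set (E →L[ℝ] F) :=
  convexHull ℝ {L | ∃ u : ℕ → E, (∀ n, DifferentiableAt ℝ f (u n)) ∧
    Tendsto u atTop (𝓝 a) ∧ Tendsto (fun n => fderiv ℝ f (u n)) atTop (𝓝 L)}

/-- In a finite-dimensional space the convex hull of a compact set is compact. -/
theorem IsCompact.convexHull_of_finiteDimensional {E : Type*} [NormedAddCommGroup E]
    [NormedSpace ℝ E] [FiniteDimensional ℝ E] {s : Set E} (hs : IsCompact s) :
    IsCompact (convexHull ℝ s) := by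
  obtain rfl | ⟨a, ha⟩ := s.eq_empty_or_nonempty
  · simp
  set N := Module.finrank ℝ E + 1
  have key : convexHull ℝ s = (fun q : (Fin N → ℝ) × (Fin N → E) => ∑ i, q.1 i • q.2 i) ''
      (stdSimplex ℝ (Fin N) ×ˢ Set.univ.pi fun _ => s) := by
    apply Set.Subset.antisymm
    · intro x hx
      obtain ⟨ι, _, z, w, hz, hind, hpos, hsum, rfl⟩ := eq_pos_convex_span_of_mem_convexHull hx
      have hcard : Fintype.card ι ≤ N :=
        hind.card_le_finrank_succ.trans (Nat.succ_le_succ (Submodule.finrank_le _))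
      obtain ⟨e⟩ : Nonempty (ι ↪ Fin N) :=
        Function.Embedding.nonempty_of_card_le (by simpa using hcard)
      refine ⟨(Function.extend e w 0, Function.extend e z fun _ => a), ⟨⟨fun i => ?_, ?_⟩, ?_⟩, ?_⟩
      · by_cases hi : ∃ j, e j = i
        · obtain ⟨j, rfl⟩ := hi
          simpa [e.injective.extend_apply] using (hpos j).le
        · simp [Function.extend_apply' _ _ _ hi]
      · rw [← hsum]
        refine (Fintype.sum_of_injective e e.injective _ _ (fun i hi => ?_) fun i => ?_).symm
        · exact Function.extend_apply' _ _ _ hi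
        · simp [e.injective.extend_apply]
      · intro i _
        by_cases hi : ∃ j, e j = i
        · obtain ⟨j, rfl⟩ := hi
          simpa [e.injective.extend_apply] using hz ⟨j, rfl⟩
        · simpa [Function.extend_apply' _ _ _ hi] using ha
      · refine (Fintype.sum_of_injective e e.injective _ _ (fun i hi => ?_) fun i => ?_).symm
        · simp [Function.extend_apply' _ _ _ hi]
        · simp [e.injective.extend_apply]
    · rintro _ ⟨q, ⟨hq₁, hq₂⟩, rfl⟩
      exact (convex_convexHull ℝ s).sum_mem (fun i _ => hq₁.1 i) hq₁.2
        fun i _ => subset_convexHull ℝ s (hq₂ i (Set.mem_univ i))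
  rw [key]
  exact ((isCompact_stdSimplex ℝ (Fin N)).prod (isCompact_univ_pi fun _ => hs)).image
    (by fun_prop)

/-- A closed convex set at distance at least `d` from the origin lies in a half-space at
distance `d` from the origin. -/
theorem Convex.exists_le_inner {Y : Type*} [NormedAddCommGroup Y] [InnerProductSpace ℝ Y]
    [CompleteSpace Y] {K : Set Y} (hK : IsClosed K) (hconv : Convex ℝ K) {d : ℝ} (hd : 0 < d)
    (hnorm : ∀ c ∈ K, d ≤ ‖c‖) : ∃ w : Y, ‖w‖ ≤ 1 ∧ ∀ c ∈ K, d ≤ inner ℝ w c := by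
  obtain rfl | hne := K.eq_empty_or_nonempty
  · exact ⟨0, by simp⟩
  obtain ⟨p, hp, hmin⟩ := exists_norm_eq_iInf_of_complete_convex hne hK.isComplete hconv 0
  rw [norm_eq_iInf_iff_real_inner_le_zero hconv hp] at hmin
  have hp0 : 0 < ‖p‖ := hd.trans_le (hnorm p hp)
  refine ⟨‖p‖⁻¹ • p, by rw [norm_smul]; simp [hp0.ne'], fun c hc => ?_⟩
  have h := hmin c hc
  rw [zero_sub, inner_neg_left, inner_sub_right, real_inner_self_eq_norm_sq] at h
  rw [inner_smul_left, RCLike.conj_to_real, inv_mul_eq_div, le_div_iff₀ hp0]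
  nlinarith [hnorm p hp]

/-- A mean value inequality for Lipschitz maps: a bound for a directional derivative at the points
of differentiability gives a bound for increments. -/
theorem LipschitzOnWith.map_add_sub_le_of_fderiv_le {E F : Type*} [NormedAddCommGroup E]
    [NormedSpace ℝ E] [FiniteDimensional ℝ E] [NormedAddCommGroup F] [NormedSpace ℝ F]
    [FiniteDimensional ℝ F] {f : E → F} {C : NNReal} {U : Set E} (hf : LipschitzOnWith C f U)
    (hU : IsOpen U) (hconv : Convex ℝ U) (L : F →L[ℝ] ℝ) {v : E} {c : ℝ}
    (hc : ∀ p ∈ U, DifferentiableAt ℝ f p → L (fderiv ℝ f p v) ≤ c)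
    {p : E} (hp : p ∈ U) (hpv : p + v ∈ U) : L (f (p + v) - f p) ≤ c := by
  borelize E
  let μ : MeasureTheory.Measure E := MeasureTheory.Measure.addHaar
  have hdiff : ∀ᵐ q ∂μ, q ∈ {q | DifferentiableAt ℝ f q} ∪ Uᶜ := by
    filter_upwards [hf.ae_differentiableWithinAt_of_mem (μ := μ)] with q hq
    by_cases hqU : q ∈ U
    · exact Or.inl ((hq hqU).differentiableAt (hU.mem_nhds hqU))
    · exact Or.inr hqU
  have hline := (MeasureTheory.ae_ae_add_linearMap_mem_iff (LinearMap.toSpanSingleton ℝ E v)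
    MeasureTheory.volume μ ((measurableSet_of_differentiableAt ℝ f).union
      hU.measurableSet.compl)).2 hdiff
  have hgood : ∀ q ∈ U, q + v ∈ U → (∀ᵐ t : ℝ, q + t • v ∈ {q | DifferentiableAt ℝ f q} ∪ Uᶜ) →
      L (f (q + v) - f q) ≤ c := by
    intro q hq hqv hae
    have hseg : ∀ t ∈ Set.Icc (0 : ℝ) 1, q + t • v ∈ U := fun t ht => by
      have := hconv.add_smul_sub_mem hq hqv ht
      simpa using this
    let g : ℝ → ℝ := fun t => L (f (q + t • v))
    have hlin : LipschitzWith ‖v‖₊ fun t : ℝ => q + t • v := by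
      refine LipschitzWith.of_dist_le_mul fun s t => ?_
      rw [dist_add_left, dist_eq_norm, ← sub_smul, norm_smul, mul_comm, dist_eq_norm]
      rfl
    have hg : LipschitzOnWith (‖L‖₊ * (C * ‖v‖₊)) g (Set.uIcc 0 1) := by
      rw [Set.uIcc_of_le zero_le_one]
      exact L.lipschitz.comp_lipschitzOnWith (hf.comp hlin.lipschitzOnWith hseg)
    have hac := hg.absolutelyContinuousOnInterval
    have hle : ∫ t in (0 : ℝ)..1, deriv g t ≤ ∫ _t in (0 : ℝ)..1, c := by
      refine intervalIntegral.integral_mono_ae_restrict zero_le_one hac.intervalIntegrable_deriv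
        intervalIntegrable_const ?_
      rw [Filter.EventuallyLE, MeasureTheory.ae_restrict_iff' measurableSet_Icc]
      filter_upwards [hae] with t ht ht01
      have htU := hseg t ht01
      have hd : DifferentiableAt ℝ f (q + t • v) := ht.resolve_right fun h => h htU
      have hder : HasDerivAt g (L (fderiv ℝ f (q + t • v) v)) t := by
        have h1 : HasDerivAt (fun t : ℝ => q + t • v) v t := by
          simpa using ((hasDerivAt_id t).smul_const v).const_add q
        exact L.hasFDerivAt.comp_hasDerivAt t (hd.hasFDerivAt.comp_hasDerivAt t h1)
      rw [hder.deriv]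
      exact hc _ htU hd
    rw [hac.integral_deriv_eq_sub] at hle
    simpa [g] using hle
  have hcont : ContinuousOn f U := hf.continuousOn
  have hT : Tendsto (fun q => L (f (q + v) - f q)) (𝓝 p) (𝓝 (L (f (p + v) - f p))) := by
    have h1 : ContinuousAt f p := hcont.continuousAt (hU.mem_nhds hp)
    have h2 : ContinuousAt f (p + v) := hcont.continuousAt (hU.mem_nhds hpv)
    have h3 : ContinuousAt (fun q => f (q + v)) p :=
      ContinuousAt.comp (f := fun q => q + v) h2 (by fun_prop)
    exact (L.continuous.continuousAt.comp (h3.sub h1)).tendsto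
  refine le_of_tendsto_of_frequently hT ?_
  rw [frequently_iff]
  intro S hS
  have hpre : (fun q => q + v) ⁻¹' U ∈ 𝓝 p :=
    (continuous_add_const v).continuousAt.preimage_mem_nhds (hU.mem_nhds hpv)
  have hN : S ∩ (U ∩ (fun q => q + v) ⁻¹' U) ∈ 𝓝 p :=
    inter_mem hS (inter_mem (hU.mem_nhds hp) hpre)
  obtain ⟨q, hq, hq'⟩ :=
    ((MeasureTheory.frequently_ae_mem_iff.2
      (MeasureTheory.Measure.measure_pos_of_mem_nhds μ hN).ne').and_eventually hline).exists
  exact ⟨q, hq.1, hgood q hq.2.1 hq.2.2 (by simpa using hq')⟩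

section ClarkeJacobian

variable {E F : Type*} [NormedAddCommGroup E] [NormedSpace ℝ E] [NormedAddCommGroup F]
  [NormedSpace ℝ F] {f : E → F} {a : E}

/-- The limits of derivatives at points tending to `a` are the cluster points of `fderiv ℝ f`
along the points of differentiability near `a`. -/
theorem exists_tendsto_fderiv_iff_mapClusterPt {L : E →L[ℝ] F} :
    (∃ u : ℕ → E, (∀ n, DifferentiableAt ℝ f (u n)) ∧
      Tendsto u atTop (𝓝 a) ∧ Tendsto (fun n => fderiv ℝ f (u n)) atTop (𝓝 L)) ↔
    MapClusterPt L (𝓝 a ⊓ 𝓟 {x | DifferentiableAt ℝ f x}) (fderiv ℝ f) := by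
  constructor
  · rintro ⟨u, hu, hua, huL⟩
    exact MapClusterPt.of_comp (tendsto_inf.2 ⟨hua, tendsto_principal.2 (.of_forall hu)⟩)
      huL.mapClusterPt
  · intro h
    obtain ⟨u, huL, hu⟩ := h.exists_seq_tendsto
    obtain ⟨hua, hud⟩ := tendsto_inf.1 hu
    obtain ⟨N, hN⟩ := eventually_atTop.1 (tendsto_principal.1 hud)
    exact ⟨fun n => u (n + N), fun n => hN _ (Nat.le_add_left N n),
      (tendsto_add_atTop_iff_nat N).2 hua,
      (tendsto_add_atTop_iff_nat (f := fun n => fderiv ℝ f (u n)) N).2 huL⟩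

variable [FiniteDimensional ℝ E] [FiniteDimensional ℝ F] {C : NNReal} {W : Set E}

theorem LipschitzOnWith.isCompact_clarkeJacobian (hf : LipschitzOnWith C f W) (hW : W ∈ 𝓝 a) :
    IsCompact (clarkeJacobian f a) := by
  refine IsCompact.convexHull_of_finiteDimensional (Metric.isCompact_of_isClosed_isBounded ?_ ?_)
  · simp only [exists_tendsto_fderiv_iff_mapClusterPt]
    exact isClosed_setOfPred_clusterPt
  · refine (Metric.isBounded_closedBall (x := 0) (r := C)).subset ?_
    rintro L ⟨u, -, hua, huL⟩
    refine Metric.isClosed_closedBall.mem_of_tendsto huL ?_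
    filter_upwards [hua (eventually_mem_nhds_iff.2 hW)] with n hn
    simpa using norm_fderiv_le_of_lipschitzOn ℝ hn hf

/-- The Clarke generalized Jacobian is upper semicontinuous with respect to derivatives. -/
theorem LipschitzOnWith.eventually_exists_clarkeJacobian_norm_sub_lt
    (hf : LipschitzOnWith C f W) (hW : W ∈ 𝓝 a) {ε : ℝ} (hε : 0 < ε) :
    ∀ᶠ x in 𝓝 a, DifferentiableAt ℝ f x → ∃ A ∈ clarkeJacobian f a, ‖fderiv ℝ f x - A‖ < ε := by
  by_contra hcon
  set B : Set E := {x | DifferentiableAt ℝ f x ∧ ∀ A ∈ clarkeJacobian f a, ε ≤ ‖fderiv ℝ f x - A‖}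
  have hB : (𝓝 a ⊓ 𝓟 B).NeBot := by
    rw [← frequently_mem_iff_neBot]
    simpa [Filter.not_eventually, B] using hcon
  have hle : map (fderiv ℝ f) (𝓝 a ⊓ 𝓟 B) ≤ 𝓟 (Metric.closedBall 0 C) := by
    rw [le_principal_iff, mem_map]
    filter_upwards [mem_inf_of_left (eventually_mem_nhds_iff.2 hW)] with x hx
    simpa using norm_fderiv_le_of_lipschitzOn ℝ hx hf
  obtain ⟨L, -, hL⟩ := isCompact_closedBall (0 : E →L[ℝ] F) C hle
  have hL' : MapClusterPt L (𝓝 a ⊓ 𝓟 B) (fderiv ℝ f) := hL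
  have hLmem : L ∈ clarkeJacobian f a :=
    subset_convexHull ℝ _ (exists_tendsto_fderiv_iff_mapClusterPt.2
      (hL'.mono (inf_le_inf_left _ (principal_mono.2 fun x hx => hx.1))))
  obtain ⟨x, hx, hxB⟩ := ((hL'.frequently (Metric.ball_mem_nhds L hε)).and_eventually
    (mem_inf_of_right (mem_principal_self B))).exists
  rw [dist_eq_norm] at hx
  exact absurd hx (hxB.2 L hLmem).not_gt

end ClarkeJacobian

/-- A compact family of injective linear maps is uniformly bounded below. -/
theorem IsCompact.exists_pos_mul_norm_le {Y Z : Type*} [NormedAddCommGroup Y] [NormedSpace ℝ Y]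
    [FiniteDimensional ℝ Y] [NormedAddCommGroup Z] [NormedSpace ℝ Z] {K : Set (Y →L[ℝ] Z)}
    (hK : IsCompact K) (hinj : ∀ A ∈ K, ∀ y, A y = 0 → y = 0) :
    ∃ d > 0, ∀ A ∈ K, ∀ y, d * ‖y‖ ≤ ‖A y‖ := by
  obtain ⟨d, hd, h⟩ := (hK.prod (isCompact_sphere (0 : Y) 1)).exists_forall_le'
    (f := fun q => ‖q.1 q.2‖) (a := 0) (by fun_prop) (by
      rintro ⟨A, y⟩ ⟨hA, hy⟩
      refine norm_pos_iff.2 fun h => ?_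
      have := hinj A hA y h
      simp [this] at hy)
  refine ⟨d, hd, fun A hA y => ?_⟩
  obtain rfl | hy := eq_or_ne y 0
  · simp
  have hy' : 0 < ‖y‖ := norm_pos_iff.2 hy
  have := h (A, ‖y‖⁻¹ • y) ⟨hA, by simp [norm_smul, hy'.ne']⟩
  rw [map_smul, norm_smul, norm_inv, norm_norm, inv_mul_eq_div, le_div_iff₀ hy'] at this
  exact this

section PartialInverse

variable {X Y : Type*} [NormedAddCommGroup X]
  [NormedAddCommGroup Y] [InnerProductSpace ℝ Y] [FiniteDimensional ℝ Y]

/-- If a compact convex set of endomorphisms is bounded below by `d`, then every unit vector `w`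
admits a direction that all of its members move along `w` by at least `d`. -/
theorem exists_forall_le_inner_apply {K : Set (Y →L[ℝ] Y)} (hK : IsCompact K) (hconv : Convex ℝ K)
    {d : ℝ} (hd : 0 < d) (hbound : ∀ A ∈ K, ∀ y, d * ‖y‖ ≤ ‖A y‖) {w : Y} (hw : ‖w‖ = 1) :
    ∃ v : Y, ‖v‖ ≤ 1 ∧ ∀ A ∈ K, d ≤ inner ℝ w (A v) := by
  let T : (Y →L[ℝ] Y) →ₗ[ℝ] Y :=
    { toFun := fun A => A.adjoint w
      map_add' := by simp
      map_smul' := by simp }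
  have hT : Continuous T := T.continuous_of_finiteDimensional
  obtain ⟨v, hv, h⟩ := (hconv.linear_image T).exists_le_inner (hK.image hT).isClosed hd (by
    rintro _ ⟨A, hA, rfl⟩
    change d ≤ ‖A.adjoint w‖
    have hinj : Function.Injective A := by
      rw [injective_iff_map_eq_zero]
      intro y hy
      have := hbound A hA y
      rw [hy, norm_zero] at this
      exact norm_le_zero_iff.1 (nonpos_of_mul_nonpos_right this hd)
    obtain ⟨y, rfl⟩ := LinearMap.surjective_of_injective (f := A.toLinearMap) hinj w
    change ‖A y‖ = 1 at hw
    change d ≤ ‖A.adjoint (A y)‖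
    have h1 : (1 : ℝ) ≤ ‖A.adjoint (A y)‖ * ‖y‖ := by
      calc (1 : ℝ) = inner ℝ (A.adjoint (A y)) y := by
            rw [ContinuousLinearMap.adjoint_inner_left, real_inner_self_eq_norm_sq, hw, one_pow]
        _ ≤ _ := real_inner_le_norm _ _
    have h2 := hbound A hA y
    rw [hw] at h2
    nlinarith [norm_nonneg y, norm_nonneg (A.adjoint (A y))])
  refine ⟨v, hv, fun A hA => ?_⟩
  have := h _ ⟨A, hA, rfl⟩
  change d ≤ inner ℝ v (A.adjoint w) at this
  rwa [ContinuousLinearMap.adjoint_inner_right, real_inner_comm] at this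

/-- Under expansion in the second variable, the equation `f (x, y) = z` can be solved for `y`
whenever `x` and `z` are close to the base point. -/
theorem LipschitzOnWith.exists_solution {f : X × Y → Y} {C : NNReal} {x₀ : X} {y₀ : Y} {δ r : ℝ}
    (hδ : 0 < δ) (hr : 0 < r) (hf : LipschitzOnWith C f (Metric.ball (x₀, y₀) r))
    (hexp : ∀ x y y', (x, y) ∈ Metric.ball (x₀, y₀) r → (x, y') ∈ Metric.ball (x₀, y₀) r →
      δ * ‖y' - y‖ ≤ ‖f (x, y') - f (x, y)‖)
    (hdir : ∀ w : Y, ‖w‖ = 1 → ∃ v : Y, ‖v‖ ≤ 1 ∧ ∀ x y, ∀ t : ℝ, 0 ≤ t →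
      (x, y) ∈ Metric.ball (x₀, y₀) r → (x, y + t • v) ∈ Metric.ball (x₀, y₀) r →
        δ * t ≤ inner ℝ w (f (x, y + t • v) - f (x, y))) :
    ∃ s > 0, ∀ x z, ‖x - x₀‖ < s → ‖z - f (x₀, y₀)‖ < s →
      ∃ y, (x, y) ∈ Metric.ball (x₀, y₀) r ∧ f (x, y) = z := by
  have hmem : ∀ x y, (x, y) ∈ Metric.ball (x₀, y₀) r ↔ ‖x - x₀‖ < r ∧ ‖y - y₀‖ < r := by
    intro x y
    rw [mem_ball_iff_norm, Prod.mk_sub_mk, Prod.norm_mk, max_lt_iff]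
  have hC : (0 : ℝ) ≤ C := C.2
  refine ⟨min r (δ * (r / 2) / (2 * (C + 1))), by positivity, fun x z hx hz => ?_⟩
  obtain ⟨hxr, hxs⟩ := lt_min_iff.1 hx
  have hzs := (lt_min_iff.1 hz).2
  have hball : ∀ y, ‖y - y₀‖ ≤ r / 2 → (x, y) ∈ Metric.ball (x₀, y₀) r := fun y hy =>
    (hmem x y).2 ⟨hxr, by linarith⟩
  have hcont : ContinuousOn (fun y => ‖f (x, y) - z‖) (Metric.closedBall y₀ (r / 2)) := by
    refine ((hf.continuousOn.comp (by fun_prop) fun y hy => ?_).sub continuousOn_const).norm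
    exact hball y (mem_closedBall_iff_norm.1 hy)
  obtain ⟨y, hy, hmin⟩ := (isCompact_closedBall y₀ (r / 2)).exists_isMinOn
    ⟨y₀, Metric.mem_closedBall_self (by positivity)⟩ hcont
  have hmin : ∀ y', ‖y' - y₀‖ ≤ r / 2 → ‖f (x, y) - z‖ ≤ ‖f (x, y') - z‖ := fun y' hy' =>
    hmin (mem_closedBall_iff_norm.2 hy')
  rw [mem_closedBall_iff_norm] at hy
  have hy₀ : (x, y₀) ∈ Metric.ball (x₀, y₀) r := hball y₀ (by simp; positivity)
  have hyr := hball y hy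
  have hint : ‖y - y₀‖ < r / 2 := by
    have h1 := hexp x y₀ y hy₀ hyr
    have h2 := hmin y₀ (by simp; positivity)
    have h3 : ‖f (x, y₀) - f (x₀, y₀)‖ ≤ C * ‖x - x₀‖ := by
      have := hf.norm_sub_le hy₀ (Metric.mem_ball_self hr)
      simpa [Prod.norm_def] using this
    have h4 : ‖f (x, y₀) - z‖ ≤ ‖f (x, y₀) - f (x₀, y₀)‖ + ‖z - f (x₀, y₀)‖ := by
      rw [norm_sub_rev z]
      exact norm_sub_le_norm_sub_add_norm_sub _ _ _
    have h5 : ‖f (x, y) - f (x, y₀)‖ ≤ ‖f (x, y) - z‖ + ‖f (x, y₀) - z‖ := by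
      rw [norm_sub_rev (f (x, y₀)) z]
      exact norm_sub_le_norm_sub_add_norm_sub _ _ _
    have h6 : 2 * (C * ‖x - x₀‖ + ‖z - f (x₀, y₀)‖) < δ * (r / 2) := by
      have h7 : 2 * (C + 1) * (δ * (r / 2) / (2 * (C + 1))) = δ * (r / 2) := by field_simp
      nlinarith [mul_le_mul_of_nonneg_left hxs.le hC]
    nlinarith
  refine ⟨y, hyr, ?_⟩
  by_contra hne
  set e := f (x, y) - z
  have he : 0 < ‖e‖ := norm_pos_iff.2 (sub_ne_zero.2 hne)
  obtain ⟨v, hv, hmove⟩ := hdir (-(‖e‖⁻¹ • e)) (by simp [norm_smul, he.ne'])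
  set t := min (r / 2 - ‖y - y₀‖) (δ * ‖e‖ / (C ^ 2 + 1))
  have ht : 0 < t := lt_min (by linarith) (by positivity)
  have ht1 : t ≤ r / 2 - ‖y - y₀‖ := min_le_left _ _
  have ht2 : t * (C ^ 2 + 1) ≤ δ * ‖e‖ := (le_div_iff₀ (by positivity)).1 (min_le_right _ _)
  have htv : ‖t • v‖ ≤ t := by
    rw [norm_smul, Real.norm_of_nonneg ht.le]
    exact mul_le_of_le_one_right ht.le hv
  have hy' : ‖y + t • v - y₀‖ ≤ r / 2 := by
    rw [add_sub_right_comm]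
    exact (norm_add_le _ _).trans (by linarith)
  have hyr' := hball _ hy'
  have hdec := hmove x y t ht.le hyr hyr'
  set Δ := f (x, y + t • v) - f (x, y)
  have hΔ : ‖Δ‖ ≤ C * t := by
    have := hf.norm_sub_le hyr' hyr
    rw [Prod.mk_sub_mk, sub_self, add_sub_cancel_left, Prod.norm_mk, norm_zero,
      max_eq_right (norm_nonneg _)] at this
    exact this.trans (by gcongr)
  rw [inner_neg_left, inner_smul_left, RCLike.conj_to_real, inv_mul_eq_div, ← neg_div,
    le_div_iff₀ he] at hdec
  have hle : ‖e‖ ≤ ‖e + Δ‖ := by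
    have := hmin _ hy'
    rwa [show f (x, y + t • v) - z = e + Δ by simp only [e, Δ]; abel] at this
  have hsq : ‖e‖ ^ 2 ≤ ‖e + Δ‖ ^ 2 := by gcongr
  rw [norm_add_sq_real] at hsq
  have hΔ2 : ‖Δ‖ ^ 2 ≤ (C * t) ^ 2 := by gcongr
  have hpos : 0 < δ * ‖e‖ * t := by positivity
  nlinarith [mul_le_mul_of_nonneg_right ht2 ht.le, sq_nonneg t]

variable [NormedSpace ℝ X] [FiniteDimensional ℝ X]

/-- If the Clarke generalized Jacobian is nonsingular in the second variable, then `f` is uniformly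
expanding in that variable and can be moved in every direction at a uniform rate. -/
theorem LipschitzOnWith.exists_expansion {f : X × Y → Y} {C : NNReal} {W : Set (X × Y)}
    {p₀ : X × Y} (hf : LipschitzOnWith C f W) (hW : W ∈ 𝓝 p₀)
    (hker : ∀ ℓ ∈ clarkeJacobian f p₀, ∀ y, ℓ (0, y) = 0 → y = 0) :
    ∃ δ > 0, ∃ r > 0, LipschitzOnWith C f (Metric.ball p₀ r) ∧
      (∀ x y y', (x, y) ∈ Metric.ball p₀ r → (x, y') ∈ Metric.ball p₀ r →
        δ * ‖y' - y‖ ≤ ‖f (x, y') - f (x, y)‖) ∧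
      ∀ w : Y, ‖w‖ = 1 → ∃ v : Y, ‖v‖ ≤ 1 ∧ ∀ x y, ∀ t : ℝ, 0 ≤ t → (x, y) ∈ Metric.ball p₀ r →
        (x, y + t • v) ∈ Metric.ball p₀ r → δ * t ≤ inner ℝ w (f (x, y + t • v) - f (x, y)) := by
  let R : (X × Y →L[ℝ] Y) →ₗ[ℝ] (Y →L[ℝ] Y) :=
    { toFun := fun A => A.comp (ContinuousLinearMap.inr ℝ X Y)
      map_add' := fun _ _ => rfl
      map_smul' := fun _ _ => rfl }
  have hR : Continuous R := R.continuous_of_finiteDimensional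
  set K := R '' clarkeJacobian f p₀
  have hK : IsCompact K := (hf.isCompact_clarkeJacobian hW).image hR
  have hconv : Convex ℝ K := (convex_convexHull ℝ _).linear_image R
  obtain ⟨d, hd, hbound⟩ := hK.exists_pos_mul_norm_le (by
    rintro _ ⟨ℓ, hℓ, rfl⟩ y hy
    exact hker ℓ hℓ y hy)
  obtain ⟨r, hr, hball⟩ := Metric.eventually_nhds_iff_ball.1
    ((hf.eventually_exists_clarkeJacobian_norm_sub_lt hW (half_pos hd)).and hW)
  have hfr : LipschitzOnWith C f (Metric.ball p₀ r) := hf.mono fun q hq => (hball q hq).2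
  have hmean : ∀ (w v : Y) (c : ℝ), ‖w‖ ≤ 1 → (∀ A ∈ K, c ≤ inner ℝ w (A v)) →
      ∀ x y, ∀ t : ℝ, 0 ≤ t → (x, y) ∈ Metric.ball p₀ r → (x, y + t • v) ∈ Metric.ball p₀ r →
        (c - d / 2 * ‖v‖) * t ≤ inner ℝ w (f (x, y + t • v) - f (x, y)) := by
    intro w v c hw hc x y t ht hp hpv
    have hadd : (x, y + t • v) = (x, y) + t • ((0 : X), v) := by simp
    rw [hadd] at hpv ⊢
    have := hfr.map_add_sub_le_of_fderiv_le Metric.isOpen_ball (convex_ball _ _)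
      (-(innerSL ℝ w)) (v := t • ((0 : X), v)) (c := -((c - d / 2 * ‖v‖) * t)) (by
        intro q hq hqd
        obtain ⟨A, hA, hAq⟩ := (hball q hq).1 hqd
        have h1 := hc _ ⟨A, hA, rfl⟩
        change c ≤ inner ℝ w (A (0, v)) at h1
        have h2 : inner ℝ w ((A - fderiv ℝ f q) (0, v)) ≤ d / 2 * ‖v‖ := by
          calc inner ℝ w ((A - fderiv ℝ f q) (0, v))
              ≤ ‖w‖ * ‖(A - fderiv ℝ f q) (0, v)‖ := real_inner_le_norm _ _
            _ ≤ 1 * (d / 2 * ‖v‖) := by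
                gcongr
                refine (ContinuousLinearMap.le_opNorm _ _).trans ?_
                rw [norm_sub_rev]
                gcongr
                simp [Prod.norm_def]
            _ = _ := one_mul _
        rw [sub_apply, inner_sub_right] at h2
        simp only [map_smul, neg_apply, innerSL_apply_apply, smul_eq_mul]
        nlinarith) hp hpv
    simp only [neg_apply, innerSL_apply_apply] at this
    linarith
  refine ⟨d / 2, half_pos hd, r, hr, hfr, fun x y y' hy hy' => ?_, fun w hw => ?_⟩
  · obtain h0 | h0 := eq_or_ne y' y
    · simp [h0]
    let T : (Y →L[ℝ] Y) →ₗ[ℝ] Y :=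
      { toFun := fun A => A (y' - y)
        map_add' := fun _ _ => rfl
        map_smul' := fun _ _ => rfl }
    have hT : Continuous T := T.continuous_of_finiteDimensional
    obtain ⟨w, hw, h⟩ := (hconv.linear_image T).exists_le_inner (hK.image hT).isClosed
      (mul_pos hd (norm_pos_iff.2 (sub_ne_zero.2 h0))) (by
        rintro _ ⟨A, hA, rfl⟩
        exact hbound A hA _)
    have := hmean w (y' - y) _ hw (fun A hA => h _ ⟨A, hA, rfl⟩) x y 1 zero_le_one hy (by simpa)
    simp only [one_smul, add_sub_cancel, mul_one] at this
    calc d / 2 * ‖y' - y‖ ≤ inner ℝ w (f (x, y') - f (x, y)) := by linarith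
      _ ≤ ‖w‖ * ‖f (x, y') - f (x, y)‖ := real_inner_le_norm _ _
      _ ≤ _ := mul_le_of_le_one_left (norm_nonneg _) hw
  · obtain ⟨v, hv, h⟩ := exists_forall_le_inner_apply hK hconv hd hbound hw
    refine ⟨v, hv, fun x y t ht hp hpv => le_trans ?_ (hmean w v d hw.le h x y t ht hp hpv)⟩
    gcongr
    nlinarith

/-- A Lipschitz map whose Clarke generalized Jacobian is nonsingular in the second variable is, up
to a local bilipschitz change of coordinates, the second projection. -/
theorem LipschitzOnWith.exists_local_trivialization {f : X × Y → Y} {C : NNReal} {W : Set (X × Y)}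
    {x₀ : X} {y₀ : Y} (hf : LipschitzOnWith C f W) (hW : W ∈ 𝓝 (x₀, y₀))
    (hker : ∀ ℓ ∈ clarkeJacobian f (x₀, y₀), ∀ y, ℓ (0, y) = 0 → y = 0) :
    ∃ U ∈ 𝓝 (x₀, y₀), ∃ V ∈ 𝓝 ((0 : X), f (x₀, y₀)), ∃ φ : X × Y → X × Y, ∃ ψ : X × Y → X × Y,
      φ (x₀, y₀) = (0, f (x₀, y₀)) ∧ (∃ C : NNReal, LipschitzOnWith C φ U) ∧
      (∃ C : NNReal, LipschitzOnWith C ψ V) ∧ (∀ p ∈ U, φ p ∈ V ∧ ψ (φ p) = p) ∧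
      (∀ q ∈ V, ψ q ∈ U ∧ φ (ψ q) = q) ∧ (∀ p ∈ U, f p = (φ p).2) := by
  obtain ⟨δ, hδ, r, hr, hfr, hexp, hdir⟩ := hf.exists_expansion hW hker
  obtain ⟨s, hs, hsol⟩ := hfr.exists_solution hδ hr hexp hdir
  set B := Metric.ball (x₀, y₀) r
  set V := Metric.ball ((0 : X), f (x₀, y₀)) s
  let φ : X × Y → X × Y := fun p => (p.1 - x₀, f p)
  have hφ : LipschitzOnWith (max 1 C) φ B := by
    have h1 : LipschitzWith 1 fun p : X × Y => p.1 - x₀ := by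
      refine LipschitzWith.of_dist_le_mul fun p q => ?_
      rw [dist_sub_right, NNReal.coe_one, one_mul]
      exact le_max_left _ _
    exact h1.lipschitzOnWith.prodMk hfr
  have hanti : ∀ p ∈ B, ∀ q ∈ B, dist p q ≤ max 1 ((1 + C) / δ) * dist (φ p) (φ q) := by
    rintro ⟨x, y⟩ hp ⟨x', y'⟩ hq
    have hx : ‖x - x'‖ ≤ dist (φ (x, y)) (φ (x', y')) := by
      rw [dist_eq_norm, Prod.norm_def]
      simp [φ]
    have hfd : ‖f (x, y) - f (x', y')‖ ≤ dist (φ (x, y)) (φ (x', y')) := by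
      rw [dist_eq_norm, Prod.norm_def]
      exact le_max_right _ _
    have hm : (x', y) ∈ B := by
      simp only [B, mem_ball_iff_norm, Prod.mk_sub_mk, Prod.norm_mk, max_lt_iff] at hp hq ⊢
      exact ⟨hq.1, hp.2⟩
    have h1 := hexp x' y' y hq hm
    have h2 : ‖f (x', y) - f (x, y)‖ ≤ C * ‖x - x'‖ := by
      have := hfr.norm_sub_le hm hp
      simpa [Prod.norm_def, norm_sub_rev] using this
    have h3 := norm_sub_le_norm_sub_add_norm_sub (f (x', y)) (f (x, y)) (f (x', y'))
    have hy : ‖y - y'‖ ≤ (1 + C) / δ * dist (φ (x, y)) (φ (x', y')) := by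
      rw [div_mul_eq_mul_div, le_div_iff₀ hδ]
      nlinarith [mul_le_mul_of_nonneg_left hx C.2]
    rw [dist_eq_norm (x, y), Prod.mk_sub_mk, Prod.norm_mk, max_le_iff]
    constructor
    · exact hx.trans (le_mul_of_one_le_left dist_nonneg (le_max_left _ _))
    · exact hy.trans (by gcongr; exact le_max_right _ _)
  have hsurj : ∀ q ∈ V, ∃ p ∈ B, φ p = q := by
    rintro ⟨x, z⟩ hq
    simp only [V, mem_ball_iff_norm, Prod.mk_sub_mk, Prod.norm_mk, max_lt_iff, sub_zero] at hq
    obtain ⟨y, hy, hfy⟩ := hsol (x + x₀) z (by simpa using hq.1) hq.2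
    exact ⟨_, hy, by simp [φ, hfy]⟩
  choose! ψ hψB hψ using hsurj
  have hφ₀ : φ (x₀, y₀) = (0, f (x₀, y₀)) := by simp [φ]
  have hB : B ∈ 𝓝 (x₀, y₀) := Metric.ball_mem_nhds _ hr
  have hV : V ∈ 𝓝 ((0 : X), f (x₀, y₀)) := Metric.ball_mem_nhds _ hs
  refine ⟨B ∩ φ ⁻¹' V, inter_mem hB ?_, V, hV, φ, ψ, hφ₀, ⟨_, hφ.mono Set.inter_subset_left⟩,
    ⟨Real.toNNReal (max 1 ((1 + C) / δ)), ?_⟩, fun p hp => ⟨hp.2, ?_⟩, fun q hq => ?_,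
    fun _ _ => rfl⟩
  · exact (hφ.continuousOn.continuousAt hB).preimage_mem_nhds (by rwa [hφ₀])
  · refine LipschitzOnWith.of_dist_le_mul fun q hq q' hq' => ?_
    have := hanti _ (hψB q hq) _ (hψB q' hq')
    rwa [hψ q hq, hψ q' hq', ← Real.coe_toNNReal (max 1 ((1 + C) / δ)) (by positivity)] at this
  · have := hanti _ (hψB _ hp.2) p hp.1
    rw [hψ _ hp.2, dist_self, mul_zero] at this
    exact dist_le_zero.1 this
  · refine ⟨⟨hψB q hq, ?_⟩, hψ q hq⟩
    rw [Set.mem_preimage, hψ q hq]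
    exact hq

end PartialInverse

/-- Under the LIFT hypotheses, `f` is locally a projection up to a bilipschitz
homeomorphism germ `φ` with `φ (x₀, y₀) = (0, z₀)` and `f = π ∘ φ` near `(x₀, y₀)`. -/
theorem lipschitz_local_trivialization (m k : ℕ)
    (f : EuclideanSpace ℝ (Fin m) × EuclideanSpace ℝ (Fin k) → EuclideanSpace ℝ (Fin k))
    (x₀ : EuclideanSpace ℝ (Fin m)) (y₀ : EuclideanSpace ℝ (Fin k))
    (z₀ : EuclideanSpace ℝ (Fin k))
    (hlip : ∃ C : NNReal, ∃ W ∈ 𝓝 (x₀, y₀), LipschitzOnWith C f W)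
    (hval : f (x₀, y₀) = z₀)
    (hker : ∀ ℓ ∈ clarkeJacobian f (x₀, y₀),
      ∀ v : EuclideanSpace ℝ (Fin m) × EuclideanSpace ℝ (Fin k),
        ℓ v = 0 → v.1 = 0 → v = 0) :
    ∃ U ∈ 𝓝 (x₀, y₀), ∃ V ∈ 𝓝 ((0 : EuclideanSpace ℝ (Fin m)), z₀),
      ∃ φ : EuclideanSpace ℝ (Fin m) × EuclideanSpace ℝ (Fin k) →
            EuclideanSpace ℝ (Fin m) × EuclideanSpace ℝ (Fin k),
      ∃ ψ : EuclideanSpace ℝ (Fin m) × EuclideanSpace ℝ (Fin k) →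
            EuclideanSpace ℝ (Fin m) × EuclideanSpace ℝ (Fin k),
        φ (x₀, y₀) = (0, z₀) ∧
        (∃ C : NNReal, LipschitzOnWith C φ U) ∧
        (∃ C : NNReal, LipschitzOnWith C ψ V) ∧
        (∀ p ∈ U, φ p ∈ V ∧ ψ (φ p) = p) ∧
        (∀ q ∈ V, ψ q ∈ U ∧ φ (ψ q) = q) ∧
        (∀ p ∈ U, f p = (φ p).2) := by
  subst hval
  obtain ⟨C, W, hW, hf⟩ := hlip
  exact hf.exists_local_trivialization hW fun ℓ hℓ y hy =>
    congrArg Prod.snd (hker ℓ hℓ (0, y) hy rfl)
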